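/- arXiv:1910.11556 — 2 statements merged into one kernel-verified Lean document; each statement's English description precedes it below -/
import Mathlib

section
/- Let K be a tame number field, i.e., a number field such that for every prime number p and every prime ideal 𝔭 of O_K lying above p, the ramification index e(𝔭 | p) is not divisible by p. Then the trace map Tr : O_K → ℤ, restricting the field trace of K/ℚ to the ring of integers O_K, is surjective. -/
open NumberField

/-- An algebra over a finite field with nilpotent residue kernel of length prime to the characteristic
has nonzero trace form. -/
theorem exists_trace_ne_zero_aux {F B k : Type*} [Field F] [Finite F] [CommRing B] [Algebra F B]
    [Module.Finite F B] [Field k] [Finite k] [Algebra F k]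
    (π : B →ₐ[F] k) (hπ : Function.Surjective π)
    (hnil : IsNilpotent (RingHom.ker (π : B →+* k))) (e : ℕ)
    (hcard : Nat.card B = Nat.card k ^ e) (he : (e : F) ≠ 0) :
    ∃ b : B, Algebra.trace F B b ≠ 0 := by
  have : Module.Finite F k := Module.Finite.of_finite
  have : Algebra.FormallyEtale F k := Algebra.FormallyEtale.of_isSeparable F k
  let s : k →ₐ[F] B := Algebra.FormallySmooth.liftOfSurjective (AlgHom.id F k) π hπ hnil
  let : Algebra k B := s.toRingHom.toAlgebra
  have : IsScalarTower F k B := IsScalarTower.of_algebraMap_eq fun x => (s.commutes x).symm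
  have : Module.Finite k B := Module.Finite.of_restrictScalars_finite F k B
  have : Finite B := Module.finite_of_finite F
  have hfr : Module.finrank k B = e := by
    have h := Module.natCard_eq_pow_finrank (K := k) (V := B)
    rw [hcard] at h
    exact (Nat.pow_right_injective (Finite.one_lt_card (α := k)) h).symm
  obtain ⟨x, hx⟩ : ∃ x, Algebra.trace F k x ≠ 0 := by
    simpa [LinearMap.ext_iff] using Algebra.trace_ne_zero F k
  refine ⟨algebraMap k B x, ?_⟩
  rw [← Algebra.trace_trace (S := k), Algebra.trace_algebraMap, hfr, map_nsmul, nsmul_eq_mul]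
  exact mul_ne_zero he hx

/-- If `K` is a tame number field, i.e. for every prime number `p` and every prime ideal `𝔭`
of `𝓞 K` lying over `p`, the ramification index `e(𝔭 ∣ p)` is not divisible by `p`, then the
trace map `Tr : 𝓞 K → ℤ` is surjective. -/
theorem trace_surjective_of_tame
    (K : Type*) [Field K] [NumberField K]
    (htame : ∀ p : ℕ, p.Prime → ∀ P : Ideal (𝓞 K), P.IsPrime →
      Ideal.comap (algebraMap ℤ (𝓞 K)) P = Ideal.span {(p : ℤ)} →
      ¬ (p ∣ Ideal.ramificationIdx' (Ideal.span {(p : ℤ)}) P)) :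
    Function.Surjective (Algebra.trace ℤ (𝓞 K)) := by
  rw [← LinearMap.range_eq_top]
  by_contra hne
  obtain ⟨m, hm, hle⟩ := Ideal.exists_le_maximal (LinearMap.range (Algebra.trace ℤ (𝓞 K))) hne
  have hm0 : m ≠ ⊥ := Ring.ne_bot_of_isMaximal_of_not_isField hm Int.not_isField
  obtain ⟨p, hp, rfl⟩ : ∃ p : ℕ, p.Prime ∧ m = Ideal.span {(p : ℤ)} := by
    obtain ⟨a, rfl⟩ := (IsPrincipalIdealRing.principal m).principal
    have ha : Prime a := (Ideal.span_singleton_prime (by rintro rfl; simp at hm0)).1 hm.isPrime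
    refine ⟨a.natAbs, Int.prime_iff_natAbs_prime.1 ha, ?_⟩
    simp
  set q : Ideal ℤ := Ideal.span {(p : ℤ)} with hq
  have hp' : Ideal.map (algebraMap ℤ (𝓞 K)) q ≠ ⊥ :=
    (Ideal.map_eq_bot_iff_of_injective (FaithfulSMul.algebraMap_injective ℤ (𝓞 K))).not.mpr hm0
  obtain ⟨P, hPmax, hPq⟩ := Ideal.exists_maximal_ideal_liesOver_of_isIntegral (S := 𝓞 K) q
  have hPc : Ideal.comap (algebraMap ℤ (𝓞 K)) P = q := hPq.over.symm
  have hPbot : P ≠ ⊥ := by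
    rintro rfl
    exact hp' (le_bot_iff.1 (Ideal.map_le_iff_le_comap.2 hPc.ge))
  have hnd := htame p hp P hPmax.isPrime hPc
  obtain ⟨Q, h₁, h₂⟩ := Ideal.eq_prime_pow_mul_coprime hp' P
  rw [← Ideal.IsDedekindDomain.ramificationIdx'_eq_normalizedFactors_count hp' hPmax.isPrime hPbot]
    at h₂
  set e := Ideal.ramificationIdx' q P with he
  have he0 : e ≠ 0 := fun h => hnd (h ▸ dvd_zero _)
  have hcop : IsCoprime (P ^ e) Q := (Ideal.isCoprime_iff_sup_eq.2 h₁).pow_left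
  let : Field (ℤ ⧸ q) := Ideal.Quotient.field q
  let : Field (𝓞 K ⧸ P) := Ideal.Quotient.field P
  let : Algebra (ℤ ⧸ q) (𝓞 K ⧸ Q) := Ideal.Quotient.algebraQuotientOfLEComap (by
      rw [← Ideal.map_le_iff_le_comap, h₂]
      exact Ideal.mul_le_right)
  let : Algebra (ℤ ⧸ q) (𝓞 K ⧸ P ^ e) := Ideal.Quotient.algebraQuotientOfLEComap (by
      rw [← Ideal.map_le_iff_le_comap, h₂]
      exact Ideal.mul_le_left)
  have : IsScalarTower ℤ (ℤ ⧸ q) (𝓞 K ⧸ Q) := .of_algebraMap_eq' rfl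
  have : IsScalarTower ℤ (ℤ ⧸ q) (𝓞 K ⧸ P ^ e) := .of_algebraMap_eq' rfl
  have : Module.Finite (ℤ ⧸ q) (𝓞 K ⧸ Q) := .of_restrictScalars_finite ℤ _ _
  have : Module.Finite (ℤ ⧸ q) (𝓞 K ⧸ P ^ e) := .of_restrictScalars_finite ℤ _ _
  have : Finite (ℤ ⧸ q) := Ideal.finiteQuotientOfFreeOfNeBot q hm0
  have : Finite (𝓞 K ⧸ P) := Ideal.finiteQuotientOfFreeOfNeBot P hPbot
  let E : (𝓞 K ⧸ q.map (algebraMap ℤ (𝓞 K))) ≃ₐ[ℤ ⧸ q] ((𝓞 K ⧸ P ^ e) × 𝓞 K ⧸ Q) :=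
    { __ := (Ideal.quotEquivOfEq h₂).trans (Ideal.quotientMulEquivQuotientProd (P ^ e) Q hcop),
      commutes' := Quotient.ind fun _ ↦ rfl }
  let π : (𝓞 K ⧸ P ^ e) →ₐ[ℤ ⧸ q] (𝓞 K ⧸ P) :=
    { __ := Ideal.Quotient.factor (Ideal.pow_le_self he0),
      commutes' := Quotient.ind fun _ ↦ rfl }
  obtain ⟨b, hb⟩ : ∃ b, Algebra.trace (ℤ ⧸ q) (𝓞 K ⧸ P ^ e) b ≠ 0 := by
    refine exists_trace_ne_zero_aux π (Ideal.Quotient.factor_surjective (Ideal.pow_le_self he0)) ⟨e, ?_⟩ e ?_ ?_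
    · have : RingHom.ker (π : (𝓞 K ⧸ P ^ e) →+* (𝓞 K ⧸ P)) = P.map (Ideal.Quotient.mk (P ^ e)) :=
        Ideal.Quotient.factor_ker (Ideal.pow_le_self he0)
      rw [this, ← Ideal.map_pow, Ideal.map_quotient_self, Ideal.zero_eq_bot]
    · have := map_pow (Ideal.absNorm (S := 𝓞 K)) P e
      rwa [Ideal.absNorm_apply, Ideal.absNorm_apply, Submodule.cardQuot_apply,
        Submodule.cardQuot_apply] at this
    · intro h
      apply hnd
      have : Ideal.Quotient.mk q (e : ℤ) = 0 := by simpa using h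
      rw [Ideal.Quotient.eq_zero_iff_mem, Ideal.mem_span_singleton] at this
      exact_mod_cast this
  obtain ⟨y, hy⟩ := Ideal.Quotient.mk_surjective (E.symm (b, 0))
  have hy2 : Algebra.trace ℤ (𝓞 K) y ∈ q := hle ⟨y, rfl⟩
  rw [← Algebra.intTrace_eq_trace, ← Ideal.Quotient.eq_zero_iff_mem,
    ← Algebra.trace_quotient_eq_of_isDedekindDomain, hy, Algebra.trace_eq_of_algEquiv,
    Algebra.trace_prod_apply] at hy2
  exact hb (by simpa using hy2)
end

section
/- Let K be a number field whose discriminant d_K is squarefree. Then K is tame: for every prime number p and every prime ideal 𝔭 of O_K lying above p, the ramification index e(𝔭 | p) is not divisible by p. -/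
open NumberField

open nonZeroDivisors in
lemma dvd_differentIdeal_of_intTrace_mem (A K : Type*) {B L : Type*}
    [CommRing A] [Field K] [CommRing B] [Field L]
    [Algebra A K] [Algebra B L] [Algebra A B] [Algebra K L] [Algebra A L]
    [IsScalarTower A K L] [IsScalarTower A B L] [IsDomain A] [IsFractionRing A K]
    [FiniteDimensional K L] [Algebra.IsSeparable K L] [IsIntegralClosure B A L]
    [IsIntegrallyClosed A]
    [IsFractionRing B L] [IsDedekindDomain A] [IsDedekindDomain B]
    [Module.IsTorsionFree A B] [Module.Finite A B]
    {p : Ideal A} (hp : p ≠ ⊥) (I a : Ideal B)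
    (ha : p.map (algebraMap A B) = I * a)
    (this : ∀ x ∈ a, Algebra.intTrace A B x ∈ p) : I ∣ differentIdeal A B := by
  have hp' := (Ideal.map_eq_bot_iff_of_injective
    (FaithfulSMul.algebraMap_injective A B)).not.mpr hp
  have habot : a ≠ ⊥ := fun ha' ↦ hp' (by simpa [ha'] using ha)
  have hPbot : I ≠ ⊥ := by
    rintro rfl; apply hp'
    rwa [Ideal.bot_mul] at ha
  have hP : ((I :)⁻¹ : FractionalIdeal B⁰ L) = a / p.map (algebraMap A B) := by
    apply inv_involutive.injective
    simp only [ha, FractionalIdeal.coeIdeal_mul, inv_div, mul_div_assoc]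
    rw [div_self (by simpa), mul_one, inv_inv]
  rw [Ideal.dvd_iff_le, differentialIdeal_le_iff (K := K) (L := L) hPbot, hP,
    Submodule.map_le_iff_le_comap]
  intro x hx
  rw [Submodule.restrictScalars_mem, FractionalIdeal.mem_coe,
    FractionalIdeal.mem_div_iff_of_ne_zero (by simpa using hp')] at hx
  rw [Submodule.mem_comap, LinearMap.coe_restrictScalars, ← FractionalIdeal.coe_one,
    ← div_self (G₀ := FractionalIdeal A⁰ K) (a := p) (by simpa using hp),
    FractionalIdeal.mem_coe, FractionalIdeal.mem_div_iff_of_ne_zero (by simpa using hp)]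
  simp only [FractionalIdeal.mem_coeIdeal, forall_exists_index, and_imp,
    forall_apply_eq_imp_iff₂] at hx
  intro y hy'
  obtain ⟨y, hy, rfl : algebraMap A K _ = _⟩ := (FractionalIdeal.mem_coeIdeal _).mp hy'
  obtain ⟨z, hz, hz'⟩ := hx _ (Ideal.mem_map_of_mem _ hy)
  have : Algebra.trace K L (algebraMap B L z) ∈ (p : FractionalIdeal A⁰ K) := by
    rw [← Algebra.algebraMap_intTrace (A := A)]
    exact ⟨Algebra.intTrace A B z, this z hz, rfl⟩
  rwa [mul_comm, ← smul_eq_mul, ← map_smul, Algebra.smul_def, mul_comm,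
    ← IsScalarTower.algebraMap_apply, IsScalarTower.algebraMap_apply A B L, ← hz']

/-- If the absolute discriminant is squarefree, no square of a proper ideal divides the different. -/
lemma not_sq_dvd_different (K : Type*) [Field K] [NumberField K]
    (h : Squarefree (NumberField.discr K)) (P : Ideal (𝓞 K)) (hP : P ≠ ⊤) :
    ¬ P ^ 2 ∣ differentIdeal ℤ (𝓞 K) := by
  intro hd
  have h1 := map_dvd Ideal.absNorm hd
  rw [map_pow, NumberField.absNorm_differentIdeal K, pow_two] at h1
  have := (Int.squarefree_natAbs.mpr h) _ h1
  rw [Nat.isUnit_iff, Ideal.absNorm_eq_one_iff] at this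
  exact hP this

/-- A totally ramified quadratic factor at `2` with residue field of order `2` has square dividing
the different. -/
lemma sq_dvd_different_two (K : Type*) [Field K] [NumberField K]
    (P a : Ideal (𝓞 K)) [P.IsMaximal]
    (hn : Ideal.absNorm P = 2)
    (ha : (Ideal.span {(2 : ℤ)}).map (algebraMap ℤ (𝓞 K)) = P ^ 2 * a)
    (hPa : IsCoprime P a) : P ^ 2 ∣ differentIdeal ℤ (𝓞 K) := by
  set p : Ideal ℤ := Ideal.span {(2 : ℤ)} with hp_def
  have hp : p ≠ ⊥ := by simp [hp_def]
  have : p.IsMaximal :=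
    PrincipalIdealRing.isMaximal_of_irreducible Int.prime_two.irreducible
  refine dvd_differentIdeal_of_intTrace_mem ℤ ℚ (L := K) hp _ a ha ?_
  intro x hx
  rw [← Ideal.Quotient.eq_zero_iff_mem, ← Algebra.trace_quotient_eq_of_isDedekindDomain]
  letI : Field (ℤ ⧸ p) := Ideal.Quotient.field p
  let _ : Algebra (ℤ ⧸ p) (𝓞 K ⧸ a) :=
    Ideal.Quotient.algebraQuotientOfLEComap (Ideal.map_le_iff_le_comap.mp
      (Ideal.dvd_iff_le.mp ⟨_, ha.trans (mul_comm _ _)⟩))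
  let _ : Algebra (ℤ ⧸ p) (𝓞 K ⧸ P ^ 2) :=
    Ideal.Quotient.algebraQuotientOfLEComap (Ideal.map_le_iff_le_comap.mp
      (Ideal.dvd_iff_le.mp ⟨_, ha⟩))
  have : IsScalarTower ℤ (ℤ ⧸ p) (𝓞 K ⧸ a) := .of_algebraMap_eq' rfl
  have : Module.Finite (ℤ ⧸ p) (𝓞 K ⧸ a) := .of_restrictScalars_finite ℤ _ _
  have : IsScalarTower ℤ (ℤ ⧸ p) (𝓞 K ⧸ P ^ 2) := .of_algebraMap_eq' rfl
  have : Module.Finite (ℤ ⧸ p) (𝓞 K ⧸ P ^ 2) := .of_restrictScalars_finite ℤ _ _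
  let e : (𝓞 K ⧸ p.map (algebraMap ℤ (𝓞 K))) ≃ₐ[ℤ ⧸ p] ((𝓞 K ⧸ P ^ 2) × 𝓞 K ⧸ a) :=
    { __ := (Ideal.quotEquivOfEq ha).trans
        (Ideal.quotientMulEquivQuotientProd (P ^ 2) a hPa.pow_left),
      commutes' := Quotient.ind fun _ ↦ rfl }
  have hx' : (e (Ideal.Quotient.mk _ x)).2 = 0 := by
    simpa [e, Ideal.Quotient.eq_zero_iff_mem]
  have hx1 : (e (Ideal.Quotient.mk _ x)).1 = Ideal.Quotient.mk (P ^ 2) x := by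
    simp [e]
  rw [← Algebra.trace_eq_of_algEquiv e, Algebra.trace_prod_apply, hx', map_zero, add_zero, hx1]
  -- traces of nilpotents vanish
  have nil : ∀ y ∈ P, Algebra.trace (ℤ ⧸ p) (𝓞 K ⧸ P ^ 2) (Ideal.Quotient.mk (P ^ 2) y) = 0 := by
    intro y hy
    rw [← isNilpotent_iff_eq_zero]
    refine Algebra.isNilpotent_trace_of_isNilpotent ⟨2, ?_⟩
    rw [← map_pow, Ideal.Quotient.eq_zero_iff_mem]
    exact Ideal.pow_mem_pow hy _
  have hcard : Nat.card (ℤ ⧸ p) = 2 := by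
    have := Int.card_ideal_quot 2
    simpa [hp_def] using this
  have hcardB : Nat.card (𝓞 K ⧸ P ^ 2) = 4 := by
    have : Ideal.absNorm (P ^ 2) = 4 := by rw [map_pow, hn]; norm_num
    rw [← this]; rfl
  have hfr : Module.finrank (ℤ ⧸ p) (𝓞 K ⧸ P ^ 2) = 2 := by
    have := Module.natCard_eq_pow_finrank (K := ℤ ⧸ p) (V := 𝓞 K ⧸ P ^ 2)
    rw [hcard, hcardB] at this
    exact (Nat.pow_right_injective le_rfl (show 2 ^ 2 = 2 ^ _ from this)).symm
  have htwo : ((2 : ℕ) : ℤ ⧸ p) = 0 := by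
    have : Ideal.Quotient.mk p 2 = 0 :=
      Ideal.Quotient.eq_zero_iff_mem.mpr (Ideal.mem_span_singleton_self 2)
    simpa using this
  have one : Algebra.trace (ℤ ⧸ p) (𝓞 K ⧸ P ^ 2) 1 = 0 := by
    have := Algebra.trace_algebraMap (S := 𝓞 K ⧸ P ^ 2) (1 : ℤ ⧸ p)
    rw [map_one, hfr, nsmul_eq_mul, htwo, zero_mul] at this
    exact this
  have hdich : x ∈ P ∨ x - 1 ∈ P := by
    have hc : Nat.card (𝓞 K ⧸ P) = 2 := hn
    obtain ⟨u, v, huv, hu⟩ := Nat.card_eq_two_iff.mp hc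
    have key : ∀ z : 𝓞 K ⧸ P, z = 0 ∨ z = 1 := by
      intro z
      have h01 : (0 : 𝓞 K ⧸ P) ≠ 1 := by
        have : Nontrivial (𝓞 K ⧸ P) := Ideal.Quotient.nontrivial_iff.mpr (Ideal.IsPrime.ne_top inferInstance)
        exact zero_ne_one
      have m : ∀ w : 𝓞 K ⧸ P, w = u ∨ w = v := fun w => by
        have : w ∈ ({u, v} : Set _) := hu ▸ Set.mem_univ w
        simpa using this
      have := m z; have := m 0; have := m 1
      grind
    rcases key (Ideal.Quotient.mk P x) with h | h
    · exact Or.inl (Ideal.Quotient.eq_zero_iff_mem.mp h)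
    · exact Or.inr (Ideal.Quotient.eq.mp (h.trans (map_one _).symm))
  rcases hdich with h | h
  · exact nil x h
  · have := nil _ h
    rwa [map_sub, map_one, map_sub, one, sub_zero] at this

/-- If the discriminant of a number field `K` is squarefree, then `K` is tame: for every
prime number `p` and every prime ideal `𝔭` of `𝓞 K` lying over `p`, the ramification index
`e(𝔭 ∣ p)` is not divisible by `p`. -/
theorem tame_of_squarefree_discr
    (K : Type*) [Field K] [NumberField K]
    (h : Squarefree (NumberField.discr K)) :
    ∀ p : ℕ, p.Prime → ∀ P : Ideal (𝓞 K), P.IsPrime →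
      Ideal.comap (algebraMap ℤ (𝓞 K)) P = Ideal.span {(p : ℤ)} →
      ¬ (p ∣ Ideal.ramificationIdx' (Ideal.span {(p : ℤ)}) P) := by
  intro p hp P hP hcomap hdvd
  have hpi : Prime (p : ℤ) := Nat.prime_iff_prime_int.mp hp
  have hp0 : Ideal.span {(p : ℤ)} ≠ ⊥ := by simp [hp.ne_zero]
  have hmax : (Ideal.span {(p : ℤ)}).IsMaximal :=
    PrincipalIdealRing.isMaximal_of_irreducible hpi.irreducible
  have hle : (Ideal.span {(p : ℤ)}).map (algebraMap ℤ (𝓞 K)) ≤ P :=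
    Ideal.map_le_iff_le_comap.mpr hcomap.ge
  have hmap0 := (Ideal.map_eq_bot_iff_of_injective
    (FaithfulSMul.algebraMap_injective ℤ (𝓞 K))).not.mpr hp0
  have hPbot : P ≠ ⊥ := by
    rintro rfl
    exact hmap0 (le_bot_iff.mp hle)
  have hPmax : P.IsMaximal := hP.isMaximal hPbot
  have he0 : Ideal.ramificationIdx' (Ideal.span {(p : ℤ)}) P ≠ 0 :=
    Ideal.IsDedekindDomain.ramificationIdx'_ne_zero hmap0 hP hle
  have hpow : P ^ Ideal.ramificationIdx' (Ideal.span {(p : ℤ)}) P ∣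
      (Ideal.span {(p : ℤ)}).map (algebraMap ℤ (𝓞 K)) :=
    Ideal.dvd_iff_le.mpr Ideal.le_pow_ramificationIdx'
  have h3 : ¬ P ^ 3 ∣ (Ideal.span {(p : ℤ)}).map (algebraMap ℤ (𝓞 K)) := fun h3 =>
    not_sq_dvd_different K h P hP.ne_top
      (pow_sub_one_dvd_differentIdeal ℤ P 3 hp0 h3)
  have he3 : Ideal.ramificationIdx' (Ideal.span {(p : ℤ)}) P < 3 := by
    by_contra hge
    exact h3 ((pow_dvd_pow _ (not_lt.mp hge)).trans hpow)
  have hple := Nat.le_of_dvd (Nat.pos_of_ne_zero he0) hdvd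
  have hp2 : p = 2 := by have := hp.two_le; omega
  have he2 : Ideal.ramificationIdx' (Ideal.span {(p : ℤ)}) P = 2 := by omega
  rw [he2] at hpow
  have hd1 : P ∣ differentIdeal ℤ (𝓞 K) := by
    simpa using pow_sub_one_dvd_differentIdeal ℤ P 2 hp0 hpow
  subst hp2
  -- the residue field has order two
  have hn : Ideal.absNorm P = 2 := by
    have hsq : Squarefree (Ideal.absNorm P) := by
      have h1 := map_dvd Ideal.absNorm hd1
      rw [NumberField.absNorm_differentIdeal K] at h1
      exact (Int.squarefree_natAbs.mpr h).squarefree_of_dvd h1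
    have : P.LiesOver (Ideal.span {((2 : ℕ) : ℤ)}) := ⟨hcomap.symm⟩
    have hf := Ideal.absNorm_eq_pow_inertiaDeg' P hp
    rw [hf] at hsq ⊢
    have hne : Ideal.absNorm P ≠ 1 := by
      rw [Ne, Ideal.absNorm_eq_one_iff]; exact hP.ne_top
    rw [hf] at hne
    have := (Nat.squarefree_pow_iff (n := 2) (by norm_num) (fun h0 => hne (by rw [h0, pow_zero]))).mp hsq
    rw [this.2, pow_one]
  obtain ⟨a, ha⟩ := hpow
  have hPa : IsCoprime P a := by
    have hpr := (Ideal.prime_iff_isPrime hPbot).mpr hP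
    rw [Ideal.isCoprime_iff_gcd, hpr.irreducible.gcd_eq_one_iff]
    intro hPa
    apply h3
    rw [ha, pow_succ]
    exact mul_dvd_mul_left _ hPa
  exact not_sq_dvd_different K h P hP.ne_top
    (sq_dvd_different_two K P a hn (by simpa using ha) hPa)
end
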